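/- Let H, K be bialgebras over R = k[[ℏ]] with a Hopf pairing ⟨·,·⟩ : H × K → R. Fix n ≥ 1, let Δ^(n) : H → H^{⊗n} denote the (n−1)-fold iterated comultiplication, and set δ_n := (id − 1∘ε)^{⊗n} ∘ Δ^(n) : H → H^{⊗n}. If a ∈ H satisfies δ_n(a) ∈ ℏⁿ•(H^{⊗n}), then for all y₁, …, yₙ ∈ ker ε_K one has ⟨a, y₁·y₂·⋯·yₙ⟩ ∈ ℏⁿ•R. (This is the computation underlying Proposition 3.1: the restriction of a Hopf pairing between U_ℏ(𝔤) and F_ℏ[[G]] to Drinfeld's subalgebra U_ℏ' pairs it into k[[ℏ]] against ℏ^{−n}-rescaled powers of the augmentation ideal, yielding the Hopf pairing between U_ℏ' and F_ℏ^∨.) -/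

import Mathlib

open TensorProduct

universe u

/-- `TPow R H n` is the `(n+1)`-fold tensor power `H^{⊗(n+1)}` of the `R`-module `H`. -/
noncomputable def TPow (R : Type u) [CommRing R] (H : Type u) [AddCommGroup H] [Module R H] :
    ℕ → ModuleCat.{u} R
  | 0 => ModuleCat.of R H
  | n + 1 => ModuleCat.of R (H ⊗[R] (TPow R H n))

/-- The iterated comultiplication `Δ^(n+1) : H →ₗ[R] H^{⊗(n+1)}`, with `Δ^(1) = id`. -/
noncomputable def iterComul (R : Type u) [CommRing R] (H : Type u) [Ring H] [Bialgebra R H] :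
    (n : ℕ) → (H →ₗ[R] TPow R H n)
  | 0 => LinearMap.id
  | n + 1 =>
      (TensorProduct.map (LinearMap.id (R := R) (M := H)) (iterComul R H n)).comp
        (Coalgebra.comul (R := R) (A := H))

/-- The projection `id − 1∘ε : H →ₗ[R] H`, `x ↦ x − ε(x)·1`. -/
noncomputable def counitProj (R : Type u) [CommRing R] (H : Type u) [Ring H] [Bialgebra R H] :
    H →ₗ[R] H :=
  LinearMap.id - (Algebra.linearMap R H).comp (Coalgebra.counit (R := R) (A := H))

/-- The tensor power `(id − 1∘ε)^{⊗(n+1)} : H^{⊗(n+1)} →ₗ[R] H^{⊗(n+1)}`. -/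
noncomputable def counitProjPow (R : Type u) [CommRing R] (H : Type u) [Ring H]
    [Bialgebra R H] : (n : ℕ) → (TPow R H n →ₗ[R] TPow R H n)
  | 0 => counitProj R H
  | n + 1 => TensorProduct.map (counitProj R H) (counitProjPow R H n)

/-- Drinfeld's map `δ_{n+1} = (id − 1∘ε)^{⊗(n+1)} ∘ Δ^(n+1) : H →ₗ[R] H^{⊗(n+1)}`. -/
noncomputable def deltaIter (R : Type u) [CommRing R] (H : Type u) [Ring H] [Bialgebra R H]
    (n : ℕ) : H →ₗ[R] TPow R H n :=
  (counitProjPow R H n).comp (iterComul R H n)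

/-- The factorwise extension of a pairing `p : H × K → R` to tensor squares. -/
noncomputable def pairT {R H K : Type u} [CommRing R]
    [AddCommGroup H] [Module R H] [AddCommGroup K] [Module R K]
    (p : H →ₗ[R] K →ₗ[R] R) :
    H ⊗[R] H →ₗ[R] Module.Dual R (K ⊗[R] K) :=
  (TensorProduct.dualDistrib R K K).comp (TensorProduct.map p p)

/-- The functional `x₀ ⊗ ⋯ ⊗ xₙ ↦ ∏ᵢ ⟨xᵢ, yᵢ⟩` on `H^{⊗(n+1)}` determined by `y₀, …, yₙ`. -/
noncomputable def pairPow {R H K : Type u} [CommRing R]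
    [AddCommGroup H] [Module R H] [AddCommGroup K] [Module R K]
    (p : H →ₗ[R] K →ₗ[R] R) : (n : ℕ) → (Fin (n + 1) → K) → (TPow R H n →ₗ[R] R)
  | 0, y => p.flip (y 0)
  | n + 1, y =>
      (LinearMap.mul' R R).comp
        (TensorProduct.map (p.flip (y 0)) (pairPow p n (fun i => y i.succ)))

lemma pairT_tmul_right {R H K : Type u} [CommRing R]
    [AddCommGroup H] [Module R H] [AddCommGroup K] [Module R K]
    (p : H →ₗ[R] K →ₗ[R] R) (t : H ⊗[R] H) (y z : K) :
    pairT p t (y ⊗ₜ z) =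
      LinearMap.mul' R R (TensorProduct.map (p.flip y) (p.flip z) t) := by
  induction t with
  | zero => simp
  | tmul x x' => simp [pairT]
  | add s t hs ht => simp only [map_add, LinearMap.add_apply, hs, ht]

/-- Pairing with a product factors through the iterated comultiplication. -/
lemma pairPow_iterComul {R H K : Type u} [CommRing R] [Ring H] [Ring K]
    [Bialgebra R H] [Bialgebra R K] (p : H →ₗ[R] K →ₗ[R] R)
    (hp : ∀ (x : H) (y₁ y₂ : K),
      p x (y₁ * y₂) = pairT p (Coalgebra.comul (R := R) x) (y₁ ⊗ₜ y₂))
    (n : ℕ) (y : Fin (n + 1) → K) :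
    (pairPow p n y).comp (iterComul R H n) = p.flip (List.ofFn y).prod := by
  induction n with
  | zero =>
    ext a
    change p a (y 0) = p a (List.ofFn y).prod
    simp
  | succ n ih =>
    ext a
    rw [List.ofFn_succ, List.prod_cons, LinearMap.flip_apply, hp, pairT_tmul_right,
      ← ih (fun i => y i.succ)]
    change LinearMap.mul' R R (TensorProduct.map (p.flip (y 0)) (pairPow p n fun i => y i.succ)
      (TensorProduct.map LinearMap.id (iterComul R H n) (Coalgebra.comul (R := R) a))) = _
    rw [← LinearMap.comp_apply (TensorProduct.map _ _), ← TensorProduct.map_comp,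
      LinearMap.comp_id]

lemma pairing_comp_counitProj {R H K : Type u} [CommRing R] [Ring H] [Ring K]
    [Bialgebra R H] [Bialgebra R K] (p : H →ₗ[R] K →ₗ[R] R)
    (hp : ∀ y : K, p 1 y = Coalgebra.counit (R := R) y)
    {y : K} (hy : Coalgebra.counit (R := R) y = 0) :
    (p.flip y).comp (counitProj R H) = p.flip y := by
  ext a
  simp [counitProj, Algebra.algebraMap_eq_smul_one, hp, hy]

/-- Elements of the augmentation ideal do not see the projection `id − 1∘ε`. -/
lemma pairPow_comp_counitProjPow {R H K : Type u} [CommRing R] [Ring H] [Ring K]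
    [Bialgebra R H] [Bialgebra R K] (p : H →ₗ[R] K →ₗ[R] R)
    (hp : ∀ y : K, p 1 y = Coalgebra.counit (R := R) y)
    (n : ℕ) (y : Fin (n + 1) → K) (hy : ∀ i, Coalgebra.counit (R := R) (y i) = 0) :
    (pairPow p n y).comp (counitProjPow R H n) = pairPow p n y := by
  induction n with
  | zero => exact pairing_comp_counitProj p hp (hy 0)
  | succ n ih =>
    change ((LinearMap.mul' R R).comp
      (TensorProduct.map (p.flip (y 0)) (pairPow p n fun i => y i.succ))).comp
      (TensorProduct.map (counitProj R H) (counitProjPow R H n)) = (LinearMap.mul' R R).comp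
      (TensorProduct.map (p.flip (y 0)) (pairPow p n fun i => y i.succ))
    rw [LinearMap.comp_assoc, ← TensorProduct.map_comp, pairing_comp_counitProj p hp (hy 0),
      ih _ fun i => hy i.succ]

/-- Let `H, K` be bialgebras over `R = k[[ℏ]]` with a Hopf pairing `p`.
Fix `n ≥ 1` (here `n+1`), and let `δ_{n+1} = (id − 1∘ε)^{⊗(n+1)} ∘ Δ^{(n+1)}`.  If `a ∈ H`
satisfies `δ_{n+1}(a) ∈ ℏ^{n+1}•H^{⊗(n+1)}`, then for all `y₀, …, yₙ ∈ ker ε_K` one has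
`⟨a, y₀·y₁·⋯·yₙ⟩ ∈ ℏ^{n+1}•R`. -/
theorem stmt_12 {k : Type} [Field k] [CharZero k]
    {H K : Type} [Ring H] [Ring K]
    [Bialgebra (PowerSeries k) H] [Bialgebra (PowerSeries k) K]
    (p : H →ₗ[PowerSeries k] K →ₗ[PowerSeries k] PowerSeries k)
    (hp1 : ∀ (x : H) (y₁ y₂ : K),
      p x (y₁ * y₂) = pairT p (Coalgebra.comul (R := PowerSeries k) x) (y₁ ⊗ₜ y₂))
    (hp2 : ∀ (x₁ x₂ : H) (y : K),
      p (x₁ * x₂) y = pairT p (x₁ ⊗ₜ x₂) (Coalgebra.comul (R := PowerSeries k) y))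
    (hp3 : ∀ x : H, p x 1 = Coalgebra.counit (R := PowerSeries k) x)
    (hp4 : ∀ y : K, p 1 y = Coalgebra.counit (R := PowerSeries k) y)
    (n : ℕ) (a : H)
    (ha : ∃ w : TPow (PowerSeries k) H n,
      deltaIter (PowerSeries k) H n a = (PowerSeries.X ^ (n + 1) : PowerSeries k) • w) :
    ∀ y : Fin (n + 1) → K, (∀ i, Coalgebra.counit (R := PowerSeries k) (y i) = 0) →
      ∃ r : PowerSeries k, p a (List.ofFn y).prod = PowerSeries.X ^ (n + 1) * r := by
  intro y hy
  obtain ⟨w, hw⟩ := ha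
  refine ⟨pairPow p n y w, ?_⟩
  calc p a (List.ofFn y).prod
      = pairPow p n y (iterComul _ H n a) :=
        (LinearMap.congr_fun (pairPow_iterComul p hp1 n y) a).symm
    _ = pairPow p n y (deltaIter _ H n a) :=
        (LinearMap.congr_fun (pairPow_comp_counitProjPow p hp4 n y hy) _).symm
    _ = PowerSeries.X ^ (n + 1) * pairPow p n y w := by
        rw [hw, map_smul, smul_eq_mul]
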